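/- arXiv:1611.09072 — 3 statements merged into one kernel-verified Lean document; each statement's English description precedes it below -/
import Mathlib

section
/- Let G be a simple graph on a finite vertex type V and A a set of vertices. Define a simple graph G' on V by: G'.Adj u w if and only if u ∉ A, w ∉ A, u ≠ w, and either G.Adj u w, or there exists a connected component P of the induced subgraph G[A] such that u is adjacent in G to some vertex of P and w is adjacent in G to some vertex of P. Then for all u ∉ A and v ∉ A: u and v are reachable in G if and only if u and v are reachable in G'. (This is the 'complete graph within the vertices adjacent to a component' construction of the paper, used to restore connectivity through low components after deleting the vertices of A.) -/
/-- If every step of `G` between vertices outside `A`, and every pair of distinct vertices outside `A`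
adjacent to a common component of `G[A]`, is an edge of `G'`, then a walk of `G` ending outside `A` at
`v` gives reachability in `G'`: of `v` from the start `x` if `x ∉ A`, and of `v` from each vertex
outside `A` adjacent to the component of `x` if `x ∈ A`. -/
theorem SimpleGraph.Walk.reachable_of_component_cliques {V : Type*} {G G' : SimpleGraph V} {A : Set V}
    (hadj : ∀ u w, u ∉ A → w ∉ A → G.Adj u w → G'.Adj u w)
    (hcomp : ∀ u w, u ∉ A → w ∉ A → u ≠ w → ∀ a b : A, (G.induce A).Reachable a b →
      G.Adj u a → G.Adj w b → G'.Adj u w)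
    {x v : V} (p : G.Walk x v) (hv : v ∉ A) :
    (x ∉ A → G'.Reachable x v) ∧
      ∀ hx : x ∈ A, ∀ w ∉ A, ∀ a : A, (G.induce A).Reachable a ⟨x, hx⟩ → G.Adj w a →
        G'.Reachable w v := by
  induction p with
  | nil => exact ⟨fun _ => .rfl, fun hx => absurd hx hv⟩
  | @cons x y v h p ih =>
    obtain ⟨ih_out, ih_in⟩ := ih hv
    by_cases hy : y ∈ A
    · refine ⟨fun hx => ih_in hy x hx ⟨y, hy⟩ .rfl h, fun hx w hw a ha hwa => ?_⟩
      have hxy : (G.induce A).Adj ⟨x, hx⟩ ⟨y, hy⟩ := h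
      exact ih_in hy w hw a (ha.trans hxy.reachable) hwa
    · refine ⟨fun hx => (hadj x y hx hy h).reachable.trans (ih_out hy),
        fun hx w hw a ha hwa => ?_⟩
      obtain rfl | hne := eq_or_ne w y
      · exact ih_out hy
      · exact (hcomp w y hw hy hne a ⟨x, hx⟩ ha hwa h.symm).reachable.trans (ih_out hy)

/-- If adjacent vertices of `H` are reachable from each other in `G`, then so are vertices
reachable from each other in `H`. -/
theorem SimpleGraph.Reachable.of_adj_reachable {V : Type*} {G H : SimpleGraph V}
    (h : ∀ u w, H.Adj u w → G.Reachable u w) {u v : V} (huv : H.Reachable u v) :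
    G.Reachable u v := by
  obtain ⟨p⟩ := huv
  induction p with
  | nil => exact .rfl
  | cons hadj _ ih => exact (h _ _ hadj).trans ih


/-- Deleting the vertices of `A` and adding, for each connected component `P`
of `G[A]`, a complete graph on the outside vertices adjacent to `P`, preserves
reachability among the vertices outside `A`. -/
theorem stmt_5 {V : Type*} [Fintype V] (G : SimpleGraph V) (A : Set V)
    (G' : SimpleGraph V)
    (hG' : ∀ u w : V, G'.Adj u w ↔
      (u ∉ A ∧ w ∉ A ∧ u ≠ w ∧
        (G.Adj u w ∨ ∃ P : (G.induce A).ConnectedComponent,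
          (∃ a : A, (G.induce A).connectedComponentMk a = P ∧ G.Adj u ↑a) ∧
          (∃ b : A, (G.induce A).connectedComponentMk b = P ∧ G.Adj w ↑b)))) :
    ∀ u v : V, u ∉ A → v ∉ A → (G.Reachable u v ↔ G'.Reachable u v) := by
  intro u v hu hv
  constructor
  · rintro ⟨p⟩
    refine (p.reachable_of_component_cliques (G' := G') (fun x y hx hy h => ?_)
      (fun x y hx hy hne a b hab ha hb => ?_) hv).1 hu
    · exact (hG' x y).2 ⟨hx, hy, h.ne, .inl h⟩
    · exact (hG' x y).2 ⟨hx, hy, hne, .inr ⟨(G.induce A).connectedComponentMk a, ⟨a, rfl, ha⟩,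
        b, (SimpleGraph.ConnectedComponent.sound hab).symm, hb⟩⟩
  · refine SimpleGraph.Reachable.of_adj_reachable fun x y h => ?_
    obtain ⟨-, -, -, hxy | ⟨P, ⟨a, rfl, ha⟩, b, hb, hyb⟩⟩ := (hG' x y).1 h
    · exact hxy.reachable
    · have hba := (SimpleGraph.ConnectedComponent.exact hb).map
        (SimpleGraph.Embedding.induce A).toHom
      exact ha.reachable.trans (hba.symm.trans hyb.symm.reachable)
end

section
/- Let G be a simple graph on a finite vertex type V and A a set of vertices, and let C denote the type of connected components of the induced subgraph G[A]. Define a simple graph G'' on the sum type V ⊕ C by: (inl u) and (inl w) are adjacent iff u ∉ A, w ∉ A and G.Adj u w; (inl u) and (inr P) are adjacent iff u ∉ A and u is adjacent in G to some vertex of P; and no two vertices of the form inr P are adjacent. Then for all u ∉ A and v ∉ A: u and v are reachable in G if and only if inl u and inl v are reachable in G''. (This is the 'meta-vertex' construction of the paper: each component of G_A is contracted to a single meta-vertex joined to all outside vertices adjacent to that component, and this preserves connectivity among the surviving vertices.) -/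
open Sum

/-- A map that sends adjacent vertices to reachable ones preserves reachability. -/
theorem SimpleGraph.Reachable.map_of_adj {V W : Type*} {G : SimpleGraph V} {H : SimpleGraph W}
    (f : V → W) (hf : ∀ x y, G.Adj x y → H.Reachable (f x) (f y)) {x y : V}
    (h : G.Reachable x y) : H.Reachable (f x) (f y) := by
  obtain ⟨p⟩ := h
  induction p with
  | nil => exact .refl _
  | cons hadj _ ih => exact (hf _ _ hadj).trans ih

/-- The meta-vertex construction: delete the vertices of `A`, add one
meta-vertex per connected component of `G[A]` joined to every outside vertex
adjacent to that component.  This preserves reachability among the vertices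
outside `A`. -/
theorem stmt_6 {V : Type*} [Fintype V] (G : SimpleGraph V) (A : Set V)
    (G'' : SimpleGraph (V ⊕ (G.induce A).ConnectedComponent))
    (h1 : ∀ u w : V, G''.Adj (inl u) (inl w) ↔ (u ∉ A ∧ w ∉ A ∧ G.Adj u w))
    (h2 : ∀ (u : V) (P : (G.induce A).ConnectedComponent),
      G''.Adj (inl u) (inr P) ↔
        (u ∉ A ∧ ∃ a : A, (G.induce A).connectedComponentMk a = P ∧ G.Adj u ↑a))
    (h3 : ∀ P P' : (G.induce A).ConnectedComponent, ¬ G''.Adj (inr P) (inr P')) :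
    ∀ u v : V, u ∉ A → v ∉ A →
      (G.Reachable u v ↔ G''.Reachable (inl u) (inl v)) := by
  classical
  intro u v hu hv
  constructor
  · intro h
    let f : V → V ⊕ (G.induce A).ConnectedComponent := fun x =>
      if hx : x ∈ A then inr ((G.induce A).connectedComponentMk ⟨x, hx⟩) else inl x
    have hf_mem : ∀ x (hx : x ∈ A), f x = inr ((G.induce A).connectedComponentMk ⟨x, hx⟩) :=
      fun x hx => dif_pos hx
    have hf_notMem : ∀ x, x ∉ A → f x = inl x := fun x hx => dif_neg hx
    have hf : ∀ x y, G.Adj x y → G''.Reachable (f x) (f y) := by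
      intro x y hxy
      by_cases hx : x ∈ A <;> by_cases hy : y ∈ A
      · rw [hf_mem x hx, hf_mem y hy]
        have hadj : (G.induce A).Adj ⟨x, hx⟩ ⟨y, hy⟩ := hxy
        rw [SimpleGraph.ConnectedComponent.sound hadj.reachable]
      · rw [hf_mem x hx, hf_notMem y hy]
        exact ((h2 _ _).2 ⟨hy, ⟨x, hx⟩, rfl, hxy.symm⟩).reachable.symm
      · rw [hf_notMem x hx, hf_mem y hy]
        exact ((h2 _ _).2 ⟨hx, ⟨y, hy⟩, rfl, hxy⟩).reachable
      · rw [hf_notMem x hx, hf_notMem y hy]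
        exact ((h1 _ _).2 ⟨hx, hy, hxy⟩).reachable
    have key := h.map_of_adj f hf
    rwa [hf_notMem u hu, hf_notMem v hv] at key
  · intro h
    let g : V ⊕ (G.induce A).ConnectedComponent → V := Sum.elim id fun P => (Quot.out P : A)
    have hg : ∀ (x : V) (P : (G.induce A).ConnectedComponent),
        G''.Adj (inl x) (inr P) → G.Reachable (g (inl x)) (g (inr P)) := by
      intro x P hxP
      obtain ⟨-, a, rfl, hxa⟩ := (h2 x P).1 hxP
      have ha : (G.induce A).Reachable a (Quot.out ((G.induce A).connectedComponentMk a)) :=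
        SimpleGraph.ConnectedComponent.exact (Quot.out_eq _).symm
      exact hxa.reachable.trans (ha.map (SimpleGraph.Embedding.induce A).toHom)
    refine h.map_of_adj g ?_
    rintro (x | P) (y | Q) hxy
    · exact ((h1 x y).1 hxy).2.2.reachable
    · exact hg x Q hxy
    · exact (hg y P hxy.symm).symm
    · exact (h3 P Q hxy).elim
end

section
/- Let G be a finite simple graph with m ≥ 1 edges, let A be a set of vertices all of whose members have degree at most (m : ℝ)^(1/4), and let B be the set of vertices of degree strictly greater than (m : ℝ)^(1/4). Then the cardinality of B plus the number of connected components of the induced subgraph G[A] whose degree sum ∑_{v ∈ P} deg_G(v) is strictly greater than (m : ℝ)^(1/4) is at most 4·(m : ℝ)^(3/4). (This is the paper's claim that the graph H, whose vertices are V_B ∪ C together with one meta-vertex per high component, has O(m^{3/4}) vertices.) -/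
open scoped Classical

/-- Markov's inequality for the counting measure, at the threshold `m ^ (1/4)`. -/
theorem ncard_lt_le_two_mul_rpow {ι : Type*} [Fintype ι] (f : ι → ℕ) {m : ℕ} (hm : 1 ≤ m)
    (hf : ∑ i, f i ≤ 2 * m) :
    ({i | (m : ℝ) ^ ((1 : ℝ) / 4) < (f i : ℝ)}.ncard : ℝ) ≤ 2 * (m : ℝ) ^ ((3 : ℝ) / 4) := by
  have hm' : (0 : ℝ) < m := by exact_mod_cast hm
  have ht : 0 < (m : ℝ) ^ ((1 : ℝ) / 4) := Real.rpow_pos_of_pos hm' _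
  have hmul : (m : ℝ) ^ ((3 : ℝ) / 4) * (m : ℝ) ^ ((1 : ℝ) / 4) = m := by
    rw [← Real.rpow_add hm']
    norm_num
  refine le_of_mul_le_mul_right ?_ ht
  rw [mul_assoc, hmul, Set.ncard_eq_toFinset_card', Set.toFinset_ofPred]
  calc _ ≤ ∑ i with (m : ℝ) ^ ((1 : ℝ) / 4) < (f i : ℝ), (f i : ℝ) := by
        rw [← nsmul_eq_mul]
        exact Finset.card_nsmul_le_sum _ _ _ fun i hi => (Finset.mem_filter.mp hi).2.le
    _ ≤ ∑ i, (f i : ℝ) :=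
        Finset.sum_le_univ_sum_of_nonneg fun i => Nat.cast_nonneg _
    _ ≤ 2 * m := by exact_mod_cast hf

/-- The graph `H` of the paper has `O(m^{3/4})` vertices: the number of
vertices of degree `> m^{1/4}` plus the number of components of `G[A]` with
degree sum `> m^{1/4}` is at most `4 m^{3/4}`, where all vertices of `A` have
degree at most `m^{1/4}`. -/
theorem stmt_10 {V : Type*} [Fintype V] (G : SimpleGraph V) [DecidableRel G.Adj]
    (hm : 1 ≤ G.edgeFinset.card) (A : Set V)
    (hA : ∀ v ∈ A, (G.degree v : ℝ) ≤ (G.edgeFinset.card : ℝ) ^ ((1 : ℝ) / 4)) :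
    (((Finset.univ.filter fun v : V =>
        (G.edgeFinset.card : ℝ) ^ ((1 : ℝ) / 4) < (G.degree v : ℝ)).card : ℝ)) +
      (({P : (G.induce A).ConnectedComponent |
          (G.edgeFinset.card : ℝ) ^ ((1 : ℝ) / 4) <
            ((∑ a : A, if (G.induce A).connectedComponentMk a = P
                then G.degree (a : V) else 0 : ℕ) : ℝ)}.ncard : ℝ)) ≤
      4 * (G.edgeFinset.card : ℝ) ^ ((3 : ℝ) / 4) := by
  have hdeg := G.sum_degrees_eq_twice_card_edges
  have hB := ncard_lt_le_two_mul_rpow (fun v => G.degree v) hm hdeg.le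
  have hC := ncard_lt_le_two_mul_rpow
    (fun P : (G.induce A).ConnectedComponent =>
      ∑ a : A, if (G.induce A).connectedComponentMk a = P then G.degree (a : V) else 0) hm (by
    rw [Finset.sum_comm, ← hdeg]
    simp only [Finset.sum_ite_eq, Finset.mem_univ, if_true]
    rw [← Finset.sum_subtype (Finset.univ.filter (· ∈ A)) (by simp) fun v => G.degree v]
    exact Finset.sum_le_univ_sum_of_nonneg fun v => Nat.zero_le _)
  rw [Set.ncard_eq_toFinset_card', Set.toFinset_ofPred] at hB
  linarith
end
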